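/- Consider the quaternion QCQP with m = 4: maximize xᴴQx + 2Re(xᴴq) over x ∈ ℍⁿ subject to xᴴA_jx + 2Re(xᴴb_j) + c_j ≤ 0 for j = 1,…,4, where Q, A_j are n×n quaternion Hermitian, q, b_j ∈ ℍⁿ, c_j ∈ ℝ. Set B_0 = [[0, qᴴ],[q, Q]], B_j = [[c_j, b_jᴴ],[b_j, A_j]] for j = 1,…,4, and B_5 = [[1, 0],[0, 0]], all (n+1)×(n+1) quaternion Hermitian. Suppose X* is a feasible solution of the SDP relaxation (X* ⪰ 0, B_j • X* ≤ 0 for j = 1,…,4, B_5 • X* = 1), and suppose y_0* ∈ ℝ, y_1*, …, y_4* ≥ 0 are such that Y* := Σ_{j=1}^4 y_j*B_j − B_0 + y_0*B_5 ⪰ 0, with the complementarity conditions Y* • X* = 0 and y_j*·(B_j • X*) = 0 for j = 1,…,4. Then there exists x ∈ ℍⁿ which is feasible for the QCQP (xᴴA_jx + 2Re(xᴴb_j) + c_j ≤ 0 for all j) and whose objective value satisfies xᴴQx + 2Re(xᴴq) = B_0 • X*; moreover B_0 • X ≤ B_0 • X* for every feasible X of the SDP relaxation, so the QCQP and its SDP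 relaxation have the same optimal value, attained at x. -/

import Mathlib

open Matrix Quaternion BigOperators

/-- The quadratic form `xᴴ A x` of a quaternion matrix. -/
noncomputable def qform {m : Type*} [Fintype m] (A : Matrix m m ℍ[ℝ]) (x : m → ℍ[ℝ]) : ℍ[ℝ] :=
  star x ⬝ᵥ A.mulVec x

/-- The inner product `A • B = Re (tr (Aᴴ B))` of quaternion matrices. -/
noncomputable def qdot {m : Type*} [Fintype m] (A B : Matrix m m ℍ[ℝ]) : ℝ :=
  (Matrix.trace (Aᴴ * B)).re

/-- A quaternion matrix is Hermitian positive semidefinite: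
it is Hermitian and `xᴴ X x ≥ 0` for all `x`. -/
def qPSD {m : Type*} [Fintype m] (X : Matrix m m ℍ[ℝ]) : Prop :=
  X.IsHermitian ∧ ∀ x : m → ℍ[ℝ], 0 ≤ (star x ⬝ᵥ X.mulVec x).re

/-- The `(n+1) × (n+1)` quaternion block matrix `[[a, bᴴ], [b, A]]` with real
`(1,1)`-entry `a`, first row continuing with `bᴴ`, first column continuing
with `b`, and lower-right block `A`. -/
noncomputable def qblock {n : ℕ} (a : ℝ) (b : Fin n → ℍ[ℝ])
    (A : Matrix (Fin n) (Fin n) ℍ[ℝ]) :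
    Matrix (Unit ⊕ Fin n) (Unit ⊕ Fin n) ℍ[ℝ] :=
  Matrix.fromBlocks (Matrix.of fun _ _ => (a : ℍ[ℝ]))
    (Matrix.of fun _ j => star (b j)) (Matrix.of fun i _ => b i) A

theorem Quaternion.re_mul_comm (a b : ℍ[ℝ]) : (a * b).re = (b * a).re := by
  simp only [Quaternion.re_mul]; ring

section

variable {m : Type*} [Fintype m]

theorem qdot_add_left (A B X : Matrix m m ℍ[ℝ]) : qdot (A + B) X = qdot A X + qdot B X := by
  simp [qdot, add_mul]

theorem qdot_sub_left (A B X : Matrix m m ℍ[ℝ]) : qdot (A - B) X = qdot A X - qdot B X := by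
  simp [qdot, sub_mul]

theorem qdot_smul_left (r : ℝ) (A X : Matrix m m ℍ[ℝ]) : qdot (r • A) X = r * qdot A X := by
  have h : (r • A)ᴴ = r • Aᴴ := by
    ext1 i j
    simp only [conjTranspose_apply, Matrix.smul_apply, Quaternion.star_smul]
  simp [qdot, h]

theorem qdot_sum_left {ι : Type*} (s : Finset ι) (A : ι → Matrix m m ℍ[ℝ]) (X : Matrix m m ℍ[ℝ]) :
    qdot (∑ j ∈ s, A j) X = ∑ j ∈ s, qdot (A j) X := by
  classical
  induction s using Finset.induction_on with
  | empty => simp [qdot]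
  | insert a s ha ih => rw [Finset.sum_insert ha, Finset.sum_insert ha, qdot_add_left, ih]

theorem qdot_add_right (A X Z : Matrix m m ℍ[ℝ]) : qdot A (X + Z) = qdot A X + qdot A Z := by
  simp [qdot, mul_add]

theorem qdot_vecMulVec (A : Matrix m m ℍ[ℝ]) (x : m → ℍ[ℝ]) :
    qdot A (vecMulVec x (star x)) = (star x ⬝ᵥ A *ᵥ x).re := by
  have hre (f : m → ℍ[ℝ]) : (∑ i, f i).re = ∑ i, (f i).re :=
    map_sum (QuaternionAlgebra.reₗ (R := ℝ) (-1) 0 (-1)) f Finset.univ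
  simp only [qdot, trace, diag_apply, mul_apply, conjTranspose_apply, vecMulVec_apply,
    dotProduct, mulVec, Pi.star_apply, Finset.mul_sum, hre]
  rw [Finset.sum_comm]
  refine Finset.sum_congr rfl fun i _ => Finset.sum_congr rfl fun j _ => ?_
  rw [← Quaternion.re_star]
  simp only [star_mul, star_star]
  rw [mul_assoc, Quaternion.re_mul_comm, mul_assoc]

/-- The real part of the Hermitian form at `x a + v b`, expressed through `|a|²`, `|b|²`, `b ā`. -/
theorem re_form_right_smul_add (A : Matrix m m ℍ[ℝ]) (x v : m → ℍ[ℝ]) (a b : ℍ[ℝ]) :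
    (star (MulOpposite.op a • x + MulOpposite.op b • v) ⬝ᵥ
      A *ᵥ (MulOpposite.op a • x + MulOpposite.op b • v)).re =
    Quaternion.normSq a * (star x ⬝ᵥ A *ᵥ x).re + Quaternion.normSq b * (star v ⬝ᵥ A *ᵥ v).re
      + (((star x ⬝ᵥ A *ᵥ v) + star (star v ⬝ᵥ A *ᵥ x)) * (b * star a)).re := by
  have hs (c : ℍ[ℝ]) (w : m → ℍ[ℝ]) : star (MulOpposite.op c • w) = star c • star w := by
    ext1 i; simp
  simp only [star_add, hs, mulVec_add, mulVec_smul, add_dotProduct, dotProduct_add,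
    smul_dotProduct, dotProduct_smul, MulOpposite.smul_eq_mul_unop, MulOpposite.unop_op,
    smul_eq_mul, ← mul_assoc]
  generalize star x ⬝ᵥ A *ᵥ v = c
  generalize star v ⬝ᵥ A *ᵥ x = d
  simp [Quaternion.normSq_def']
  ring

end

/-- A nonzero Hermitian direction `[[α, β], [β̄, γ]]` can be followed from the identity until the
matrix becomes a rank-one matrix `w wᴴ`. -/
theorem exists_rank_one_of_direction (α γ : ℝ) (β : ℍ[ℝ]) (h : (α, γ, β) ≠ 0) :
    ∃ (t : ℝ) (a b : ℍ[ℝ]), Quaternion.normSq a = 1 + t * α ∧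
      Quaternion.normSq b = 1 + t * γ ∧ b * star a = t • β := by
  wlog hs : 0 ≤ α + γ generalizing α γ β
  · obtain ⟨t, a, b, h1, h2, h3⟩ := this (-α) (-γ) (-β) (by
      contrapose! h; simpa using h) (by linarith)
    exact ⟨-t, a, b, by rw [h1]; ring, by rw [h2]; ring, by rw [h3]; simp⟩
  set D : ℝ := ((α - γ) / 2) ^ 2 + Quaternion.normSq β with hD
  have hβ : 0 ≤ Quaternion.normSq β := Quaternion.normSq_nonneg
  have hD0 : 0 ≤ D := by positivity
  set l : ℝ := (α + γ) / 2 + √D with hl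
  have hsq : √D ^ 2 = D := Real.sq_sqrt hD0
  have hsd : 0 ≤ √D := Real.sqrt_nonneg D
  have habs : |(α - γ) / 2| ≤ √D := Real.abs_le_sqrt (by rw [hD]; linarith)
  have hl0 : 0 < l := by
    refine lt_of_le_of_ne (by positivity) fun h0 => h ?_
    have h1 : √D = 0 := by linarith
    have h2 : D = 0 := by rw [← hsq, h1]; norm_num
    have h3 : Quaternion.normSq β = 0 := by nlinarith [sq_nonneg ((α - γ) / 2)]
    have h4 : (α - γ) / 2 = 0 := by
      rw [← sq_eq_zero_iff]; linarith
    have h5 : α = 0 := by linarith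
    have h6 : γ = 0 := by linarith
    simp [h5, h6, Quaternion.normSq_eq_zero.mp h3]
  have hla : 0 ≤ l - α := by linarith [le_abs_self ((α - γ) / 2)]
  have hlg : 0 ≤ l - γ := by linarith [neg_abs_le ((α - γ) / 2)]
  have hp : 0 ≤ 1 + -l⁻¹ * α := by
    have : 1 + -l⁻¹ * α = (l - α) / l := by field_simp; ring
    rw [this]; positivity
  have hq : 0 ≤ 1 + -l⁻¹ * γ := by
    have : 1 + -l⁻¹ * γ = (l - γ) / l := by field_simp; ring
    rw [this]; positivity
  have hpq : (1 + -l⁻¹ * α) * (1 + -l⁻¹ * γ) = Quaternion.normSq (-l⁻¹ • β) := by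
    have h7 : (l - α) * (l - γ) = Quaternion.normSq β := by
      have : l - (α + γ) / 2 = √D := by rw [hl]; ring
      have h8 : (l - (α + γ) / 2) ^ 2 = D := by rw [this, hsq]
      rw [hD] at h8
      linarith
    rw [Quaternion.normSq_smul, ← h7]
    field_simp
    ring
  refine ⟨-l⁻¹, ?_⟩
  generalize -l⁻¹ • β = s at *
  generalize 1 + -l⁻¹ * α = p at *
  generalize 1 + -l⁻¹ * γ = r at *
  rcases hp.eq_or_lt with rfl | hp
  · refine ⟨0, (√r : ℝ), by simp, by simp [Quaternion.normSq_coe, Real.sq_sqrt hq], ?_⟩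
    rw [zero_mul, eq_comm, Quaternion.normSq_eq_zero] at hpq
    simp [hpq]
  · have hp' : √p ≠ 0 := (Real.sqrt_pos.mpr hp).ne'
    refine ⟨(√p : ℝ), (√p)⁻¹ • s, by simp [Quaternion.normSq_coe, Real.sq_sqrt hp.le], ?_, ?_⟩
    · rw [Quaternion.normSq_smul, ← hpq, inv_pow, Real.sq_sqrt hp.le]
      field_simp
    · rw [Quaternion.star_coe, Quaternion.mul_coe_eq_smul, smul_smul, mul_inv_cancel₀ hp',
        one_smul]

section

variable {m : Type*} [Fintype m]

/-- At most five Hermitian forms cannot distinguish `x xᴴ + v vᴴ` from some `z zᴴ`, where `z` is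
a right combination of `x` and `v`. -/
theorem exists_merge {ι : Type*} [Fintype ι] (hι : Fintype.card ι ≤ 5)
    (M : ι → Matrix m m ℍ[ℝ]) (x v : m → ℍ[ℝ]) :
    ∃ a b : ℍ[ℝ], ∀ j,
      (star (MulOpposite.op a • x + MulOpposite.op b • v) ⬝ᵥ
        M j *ᵥ (MulOpposite.op a • x + MulOpposite.op b • v)).re =
      (star x ⬝ᵥ M j *ᵥ x).re + (star v ⬝ᵥ M j *ᵥ v).re := by
  let L : (ℝ × ℝ × ℍ[ℝ]) →ₗ[ℝ] (ι → ℝ) :=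
    { toFun := fun p j => p.1 * (star x ⬝ᵥ M j *ᵥ x).re + p.2.1 * (star v ⬝ᵥ M j *ᵥ v).re
        + (((star x ⬝ᵥ M j *ᵥ v) + star (star v ⬝ᵥ M j *ᵥ x)) * p.2.2).re
      map_add' := fun p p' => by
        ext j
        simp only [Prod.fst_add, Prod.snd_add, mul_add, Quaternion.re_add, Pi.add_apply]
        ring
      map_smul' := fun r p => by
        ext j
        simp only [Prod.smul_fst, Prod.smul_snd, mul_smul_comm, Quaternion.re_smul, smul_eq_mul,
          Pi.smul_apply, RingHom.id_apply]
        ring }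
  have hker : LinearMap.ker L ≠ ⊥ := by
    apply LinearMap.ker_ne_bot_of_finrank_lt
    rw [Module.finrank_prod, Module.finrank_prod, Module.finrank_self,
      Quaternion.finrank_eq_four, Module.finrank_pi]
    omega
  obtain ⟨⟨α, γ, β⟩, hmem, hne⟩ := Submodule.exists_mem_ne_zero_of_ne_bot hker
  obtain ⟨t, a, b, ha, hb, hab⟩ := exists_rank_one_of_direction α γ β hne
  refine ⟨a, b, fun j => ?_⟩
  have hj : α * (star x ⬝ᵥ M j *ᵥ x).re + γ * (star v ⬝ᵥ M j *ᵥ v).re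
      + (((star x ⬝ᵥ M j *ᵥ v) + star (star v ⬝ᵥ M j *ᵥ x)) * β).re = 0 :=
    congrFun (LinearMap.mem_ker.mp hmem) j
  rw [re_form_right_smul_add, ha, hb, hab, mul_smul_comm, Quaternion.re_smul, smul_eq_mul]
  linear_combination t * hj

/-- The null cone of a positive semidefinite form is closed under right combinations. -/
theorem re_form_eq_zero_of_nonneg {Y : Matrix m m ℍ[ℝ]}
    (hY : ∀ x : m → ℍ[ℝ], 0 ≤ (star x ⬝ᵥ Y *ᵥ x).re) {x v : m → ℍ[ℝ]}
    (hx : (star x ⬝ᵥ Y *ᵥ x).re = 0) (hv : (star v ⬝ᵥ Y *ᵥ v).re = 0) (a b : ℍ[ℝ]) :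
    (star (MulOpposite.op a • x + MulOpposite.op b • v) ⬝ᵥ
      Y *ᵥ (MulOpposite.op a • x + MulOpposite.op b • v)).re = 0 := by
  have h₁ := hY (MulOpposite.op a • x + MulOpposite.op b • v)
  have h₂ := hY (MulOpposite.op a • x + MulOpposite.op (-b) • v)
  rw [re_form_right_smul_add, hx, hv] at *
  rw [neg_mul, mul_neg, Quaternion.re_neg] at h₂
  linarith

theorem qPSD.coe_re_diag {X : Matrix m m ℍ[ℝ]} (hX : qPSD X) (i : m) :
    X i i = ((X i i).re : ℍ[ℝ]) :=
  Quaternion.star_eq_self.mp (hX.1.apply i i)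

theorem qPSD.re_diag_nonneg [DecidableEq m] {X : Matrix m m ℍ[ℝ]} (hX : qPSD X) (i : m) :
    0 ≤ (X i i).re := by
  simpa [← Pi.single_star] using hX.2 (Pi.single i 1)

theorem qPSD.re_form_add_single [DecidableEq m] {X : Matrix m m ℍ[ℝ]} (hX : qPSD X) (i : m)
    (x : m → ℍ[ℝ]) (b : ℍ[ℝ]) :
    (star (x + Pi.single i b) ⬝ᵥ X *ᵥ (x + Pi.single i b)).re =
      (star x ⬝ᵥ X *ᵥ x).re + Quaternion.normSq b * (X i i).re
        + 2 * (star b * (X *ᵥ x) i).re := by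
  have h := re_form_right_smul_add X x (Pi.single i 1) 1 b
  have h1 : MulOpposite.op b • (Pi.single i 1 : m → ℍ[ℝ]) = Pi.single i b := by
    ext1 j; rcases eq_or_ne j i with rfl | hj <;> simp [*]
  have h2 : star x ⬝ᵥ X *ᵥ Pi.single i 1 = star ((X *ᵥ x) i) := by
    rw [dotProduct_mulVec, ← Pi.star_apply, star_mulVec, hX.1.eq]
    simp
  rw [h1, h2] at h
  simp at h
  simp [h]
  ring

/-- Every positive semidefinite quaternion matrix is a sum of matrices `v vᴴ`. -/
theorem qPSD.induction_vecMulVec {P : Matrix m m ℍ[ℝ] → Prop} (hzero : P 0)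
    (hadd : ∀ X v, P X → P (X + vecMulVec v (star v))) {X : Matrix m m ℍ[ℝ]} (hX : qPSD X) :
    P X := by
  classical
  induction hk : (Finset.univ.filter fun i => X i i ≠ 0).card using Nat.strong_induction_on
    generalizing X with
  | _ k ih =>
  by_cases hdiag : ∀ i, X i i = 0
  · have hX0 : X = 0 := by
      ext1 i j
      have h := hX.re_form_add_single i (Pi.single j 1) (-(X i j))
      have h' := hX.2 (Pi.single j 1 + Pi.single i (-(X i j)))
      rw [h] at h'
      simp [hdiag, Quaternion.star_mul_self] at h'
      have h0 : 0 ≤ Quaternion.normSq (X i j) := Quaternion.normSq_nonneg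
      exact Quaternion.normSq_eq_zero.mp (by linarith)
    rwa [hX0]
  · push Not at hdiag
    obtain ⟨i, hi⟩ := hdiag
    set d : ℝ := (X i i).re with hd
    have hXd : X i i = (d : ℍ[ℝ]) := hX.coe_re_diag i
    have hd0 : 0 < d := (hX.re_diag_nonneg i).lt_of_ne fun h => hi (by rw [hXd, hd, ← h]; simp)
    let v : m → ℍ[ℝ] := (√d)⁻¹ • fun j => X j i
    have hvx (x : m → ℍ[ℝ]) : star v ⬝ᵥ x = (√d)⁻¹ • ((fun j => X i j) ⬝ᵥ x) := by
      simp only [v, dotProduct, Finset.smul_sum, Pi.star_apply, Pi.smul_apply,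
        Quaternion.star_smul, hX.1.apply, smul_mul_assoc]
    have hform (x : m → ℍ[ℝ]) :
        (star x ⬝ᵥ (X - vecMulVec v (star v)) *ᵥ x).re =
          (star x ⬝ᵥ X *ᵥ x).re - d⁻¹ * Quaternion.normSq ((X *ᵥ x) i) := by
      have h : star x ⬝ᵥ vecMulVec v (star v) *ᵥ x = star (star v ⬝ᵥ x) * (star v ⬝ᵥ x) := by
        rw [vecMulVec_mulVec, dotProduct_smul, star_dotProduct]
        simp
      rw [sub_mulVec, dotProduct_sub, h, Quaternion.star_mul_self, hvx]
      rw [Quaternion.re_sub, Quaternion.re_coe, Quaternion.normSq_smul, inv_pow,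
        Real.sq_sqrt hd0.le]
      rfl
    have hX' : qPSD (X - vecMulVec v (star v)) := by
      refine ⟨hX.1.sub ?_, fun x => ?_⟩
      · simp [IsHermitian, conjTranspose_vecMulVec]
      · have h := hX.2 (x + Pi.single i (-(d⁻¹ • (X *ᵥ x) i)))
        rw [hX.re_form_add_single] at h
        rw [hform]
        simp [Quaternion.normSq_smul, Quaternion.star_mul_self, ← hd] at h
        field_simp at h ⊢
        linarith
    have hlt : (Finset.univ.filter fun j => (X - vecMulVec v (star v)) j j ≠ 0).card < k := by
      rw [← hk]
      refine Finset.card_lt_card (Finset.ssubset_iff_of_subset ?_ |>.mpr ⟨i, by simpa using hi, ?_⟩)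
      · intro j hj
        simp only [Finset.mem_filter, Finset.mem_univ, true_and] at hj ⊢
        contrapose! hj
        have h1 := hX'.re_diag_nonneg j
        rw [hX'.coe_re_diag j]
        have h2 : (vecMulVec v (star v) j j).re = Quaternion.normSq (v j) := by
          simp [vecMulVec_apply, Quaternion.self_mul_star]
        have h3 : 0 ≤ Quaternion.normSq (v j) := Quaternion.normSq_nonneg
        rw [Matrix.sub_apply, Quaternion.re_sub, hj, h2] at h1 ⊢
        rw [Quaternion.re_zero, zero_sub] at h1 ⊢
        rw [le_antisymm (by linarith) h1, Quaternion.coe_zero]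
      · have h : v i * star (v i) = X i i := by
          simp only [v, Pi.smul_apply, Quaternion.self_mul_star, Quaternion.normSq_smul, hXd,
            Quaternion.normSq_coe, inv_pow, Real.sq_sqrt hd0.le]
          congr 1
          field_simp
        rw [Finset.mem_filter, not_and, not_not]
        intro
        rw [Matrix.sub_apply, vecMulVec_apply, Pi.star_apply, h, sub_self]
    simpa using hadd _ v (ih _ hlt hX' rfl)

theorem qdot_nonneg {Y X : Matrix m m ℍ[ℝ]} (hY : qPSD Y) (hX : qPSD X) : 0 ≤ qdot Y X := by
  refine hX.induction_vecMulVec (P := fun X => 0 ≤ qdot Y X) (by simp [qdot]) fun X v h => ?_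
  rw [qdot_add_right, qdot_vecMulVec]
  exact add_nonneg h (hY.2 v)

/-- Quaternion rank-one reduction: a positive semidefinite `X` orthogonal to a positive
semidefinite `Y` can be replaced by some `x xᴴ` orthogonal to `Y` without changing the values of
at most five given linear functionals. -/
theorem exists_rank_one_qdot_eq {ι : Type*} [Fintype ι] (hι : Fintype.card ι ≤ 5)
    (M : ι → Matrix m m ℍ[ℝ]) {Y X : Matrix m m ℍ[ℝ]} (hY : qPSD Y) (hX : qPSD X)
    (hYX : qdot Y X = 0) :
    ∃ x : m → ℍ[ℝ], qdot Y (vecMulVec x (star x)) = 0 ∧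
      ∀ j, qdot (M j) (vecMulVec x (star x)) = qdot (M j) X := by
  simp only [qdot_vecMulVec]
  refine (hX.induction_vecMulVec (P := fun X => 0 ≤ qdot Y X ∧ (qdot Y X = 0 →
    ∃ x : m → ℍ[ℝ], (star x ⬝ᵥ Y *ᵥ x).re = 0 ∧
      ∀ j, (star x ⬝ᵥ M j *ᵥ x).re = qdot (M j) X)) ?_ ?_).2 hYX
  · exact ⟨by simp [qdot], fun _ => ⟨0, by simp, by simp [qdot]⟩⟩
  · rintro X v ⟨hnn, hex⟩
    have hv := hY.2 v
    rw [qdot_add_right, qdot_vecMulVec]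
    refine ⟨add_nonneg hnn hv, fun h0 => ?_⟩
    obtain ⟨x, hx, hxM⟩ := hex (by linarith)
    obtain ⟨a, b, hab⟩ := exists_merge hι M x v
    have hv0 : (star v ⬝ᵥ Y *ᵥ v).re = 0 := by linarith
    refine ⟨_, re_form_eq_zero_of_nonneg hY.2 hx hv0 a b, fun j => ?_⟩
    rw [hab, qdot_add_right, qdot_vecMulVec, hxM]

end

theorem re_form_qblock {n : ℕ} (c : ℝ) (b : Fin n → ℍ[ℝ]) (A : Matrix (Fin n) (Fin n) ℍ[ℝ])
    (x : Fin n → ℍ[ℝ]) :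
    (star (Sum.elim 1 x : Unit ⊕ Fin n → ℍ[ℝ]) ⬝ᵥ qblock c b A *ᵥ Sum.elim 1 x).re =
      (qform A x).re + 2 * (star x ⬝ᵥ b).re + c := by
  have h₁ : qblock c b A *ᵥ Sum.elim 1 x =
      Sum.elim (fun _ => (c : ℍ[ℝ]) + star b ⬝ᵥ x) (b + A *ᵥ x) := by
    rw [qblock, fromBlocks_mulVec]
    ext1 (i | i)
    · simp [mulVec, dotProduct]
    · simp [mulVec, dotProduct]
  have h₂ : star b ⬝ᵥ x = star (star x ⬝ᵥ b) := star_dotProduct b x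
  have h₃ : star (Sum.elim 1 x : Unit ⊕ Fin n → ℍ[ℝ]) = Sum.elim (1 : Unit → ℍ[ℝ]) (star x) := by
    ext1 (i | i) <;> simp
  rw [h₁, h₃, sumElim_dotProduct_sumElim, h₂, dotProduct_add, qform]
  simp
  ring

/-- Quaternion QCQP with four constraints: from a feasible solution of the SDP
relaxation together with a complementary dual solution one recovers an optimal
solution of the QCQP; the QCQP and its SDP relaxation share the optimal value. -/
theorem qcqp_four_constraints_sdp_exact {n : ℕ}
    (Q : Matrix (Fin n) (Fin n) ℍ[ℝ]) (q : Fin n → ℍ[ℝ])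
    (A : Fin 4 → Matrix (Fin n) (Fin n) ℍ[ℝ]) (b : Fin 4 → Fin n → ℍ[ℝ])
    (c : Fin 4 → ℝ) (hQ : Q.IsHermitian) (hA : ∀ j, (A j).IsHermitian)
    (X : Matrix (Unit ⊕ Fin n) (Unit ⊕ Fin n) ℍ[ℝ])
    (hXpsd : qPSD X)
    (hXfeas : ∀ j, qdot (qblock (c j) (b j) (A j)) X ≤ 0)
    (hXone : qdot (qblock 1 0 0) X = 1)
    (y₀ : ℝ) (y : Fin 4 → ℝ) (hy : ∀ j, 0 ≤ y j)
    (hYpsd : qPSD (∑ j, y j • qblock (c j) (b j) (A j)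
                    - qblock 0 q Q + y₀ • qblock 1 0 0))
    (hcomp : qdot (∑ j, y j • qblock (c j) (b j) (A j)
                    - qblock 0 q Q + y₀ • qblock 1 0 0) X = 0)
    (hcs : ∀ j, y j * qdot (qblock (c j) (b j) (A j)) X = 0) :
    ∃ x : Fin n → ℍ[ℝ],
      (∀ j, (qform (A j) x).re + 2 * (star x ⬝ᵥ b j).re + c j ≤ 0) ∧
      (qform Q x).re + 2 * (star x ⬝ᵥ q).re = qdot (qblock 0 q Q) X ∧
      ∀ X' : Matrix (Unit ⊕ Fin n) (Unit ⊕ Fin n) ℍ[ℝ], qPSD X' →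
        (∀ j, qdot (qblock (c j) (b j) (A j)) X' ≤ 0) →
        qdot (qblock 1 0 0) X' = 1 →
        qdot (qblock 0 q Q) X' ≤ qdot (qblock 0 q Q) X := by
  have hlin (Z : Matrix (Unit ⊕ Fin n) (Unit ⊕ Fin n) ℍ[ℝ]) :
      qdot (∑ j, y j • qblock (c j) (b j) (A j) - qblock 0 q Q + y₀ • qblock 1 0 0) Z =
        ∑ j, y j * qdot (qblock (c j) (b j) (A j)) Z - qdot (qblock 0 q Q) Z
          + y₀ * qdot (qblock 1 0 0) Z := by
    simp only [qdot_add_left, qdot_sub_left, qdot_sum_left, qdot_smul_left]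
  obtain ⟨z, hzY, hz⟩ := exists_rank_one_qdot_eq (ι := Option (Fin 4)) (by simp)
    (fun j => j.elim (qblock 1 0 0) fun j => qblock (c j) (b j) (A j)) hYpsd hXpsd hcomp
  have hz₁ : qdot (qblock 1 0 0) (vecMulVec z (star z)) = 1 := (hz none).trans hXone
  have hzj (j : Fin 4) : qdot (qblock (c j) (b j) (A j)) (vecMulVec z (star z)) =
      qdot (qblock (c j) (b j) (A j)) X := hz (some j)
  have hz₀ : qdot (qblock 0 q Q) (vecMulVec z (star z)) = qdot (qblock 0 q Q) X := by
    rw [hlin] at hzY hcomp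
    simp only [hzj, hz₁, hXone] at hzY hcomp
    linarith
  have hnorm : Quaternion.normSq (z (Sum.inl ())) = 1 := by
    rw [qdot_vecMulVec] at hz₁
    have h : qblock 1 0 0 *ᵥ z = Sum.elim (fun _ => z (Sum.inl ())) 0 := by
      ext1 (i | i) <;> simp [qblock, mulVec, dotProduct]
    rw [h] at hz₁
    simpa [dotProduct, Quaternion.star_mul_self] using hz₁
  have hx : vecMulVec z (star z) = vecMulVec
      (Sum.elim 1 fun i => z (Sum.inr i) * star (z (Sum.inl ())) : Unit ⊕ Fin n → ℍ[ℝ])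
      (star (Sum.elim 1 fun i => z (Sum.inr i) * star (z (Sum.inl ())))) := by
    have h₁ : star (z (Sum.inl ())) * z (Sum.inl ()) = 1 := by
      rw [Quaternion.star_mul_self, hnorm, Quaternion.coe_one]
    have h₂ : z (Sum.inl ()) * star (z (Sum.inl ())) = 1 := by
      rw [Quaternion.self_mul_star, hnorm, Quaternion.coe_one]
    have hz' : (Sum.elim 1 fun i => z (Sum.inr i) * star (z (Sum.inl ())) :
        Unit ⊕ Fin n → ℍ[ℝ]) =
        fun i => z i * star (z (Sum.inl ())) := by
      ext1 (i | i)
      · simp [h₂]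
      · simp
    ext1 i j
    simp only [hz', vecMulVec_apply, Pi.star_apply, star_mul, star_star]
    rw [mul_assoc, ← mul_assoc (star _) (z _), h₁, one_mul]
  refine ⟨fun i => z (Sum.inr i) * star (z (Sum.inl ())), fun j => ?_, ?_,
    fun X' hX' hfeas hone => ?_⟩
  · rw [← re_form_qblock, ← qdot_vecMulVec, ← hx, hzj]
    exact hXfeas j
  · rw [← hz₀, hx, qdot_vecMulVec, re_form_qblock, add_zero]
  · have h := qdot_nonneg hYpsd hX'
    rw [hlin, hone] at h
    rw [hlin, hXone] at hcomp
    simp only [hcs, Finset.sum_const_zero] at hcomp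
    have hsum : ∑ j, y j * qdot (qblock (c j) (b j) (A j)) X' ≤ 0 :=
      Finset.sum_nonpos fun j _ => mul_nonpos_of_nonneg_of_nonpos (hy j) (hfeas j)
    linarith
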